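/- Let ε ∈ {1, −1} and c ∈ ℂ, and define φ(z) = c + 2ζ(z−εp) − ζ(z) − (1/2)(ζ(z+p) + ζ(z−p)) (the logarithmic derivative of y_{a,c} with a₁ = a₂ = εp). Then there exists A ∈ ℂ such that φ' + φ² = q(·;A) on ℂ ∖ S if and only if c = 2εζ(p) and A = 3℘''(p)/(4℘'(p)). -/

import Mathlib

open Complex Filter Topology

noncomputable section

/-- The lattice `Λ_τ = ℤ + τℤ`. -/
def Lam (τ : ℂ) : Set ℂ := {ω | ∃ m n : ℤ, ω = (m : ℂ) + (n : ℂ) * τ}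

/-- The nonzero lattice points. -/
def Lam' (τ : ℂ) : Set ℂ := {ω | ω ∈ Lam τ ∧ ω ≠ 0}

/-- The Weierstrass elliptic function `℘(z; τ)`. -/
def wp (τ z : ℂ) : ℂ :=
  1 / z ^ 2 + ∑' ω : Lam' τ, (1 / (z - (ω : ℂ)) ^ 2 - 1 / (ω : ℂ) ^ 2)

/-- The Weierstrass zeta function `ζ(z; τ)`. -/
def wzeta (τ z : ℂ) : ℂ :=
  1 / z + ∑' ω : Lam' τ, (1 / (z - (ω : ℂ)) + 1 / (ω : ℂ) + z / (ω : ℂ) ^ 2)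

/-- The Weierstrass sigma function `σ(z; τ)`. -/
def wsigma (τ z : ℂ) : ℂ :=
  z * ∏' ω : Lam' τ,
    ((1 - z / (ω : ℂ)) * Complex.exp (z / (ω : ℂ) + z ^ 2 / (2 * (ω : ℂ) ^ 2)))

/-- `℘'(z; τ)`. -/
def wpd (τ : ℂ) : ℂ → ℂ := deriv (wp τ)

/-- `℘''(z; τ)`. -/
def wpdd (τ : ℂ) : ℂ → ℂ := deriv (deriv (wp τ))

/-- The constant `B(A)`. -/
def Bc (τ p A : ℂ) : ℂ :=
  A ^ 2 - wzeta τ (2 * p) * A - 3 / 4 * wp τ (2 * p) - 2 * wp τ p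

/-- The potential `q(z; A)`. -/
def qpot (τ p A z : ℂ) : ℂ :=
  2 * wp τ z + 3 / 4 * (wp τ (z + p) + wp τ (z - p))
    + A * (wzeta τ (z + p) - wzeta τ (z - p)) + Bc τ p A

/-- The singular set `S = Λ_τ ∪ (p + Λ_τ) ∪ (−p + Λ_τ)`. -/
def Sset (τ p : ℂ) : Set ℂ :=
  Lam τ ∪ {z | z - p ∈ Lam τ} ∪ {z | z + p ∈ Lam τ}

/-- The unique elliptic solution `Φ_e(z; A)` of the second symmetric product equation. -/
def Phie (τ p A z : ℂ) : ℂ :=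
  wp τ z + (A / 2 - 3 * wpdd τ p / (8 * wpd τ p)) * (wzeta τ (z + p) - wzeta τ (z - p))
    - A ^ 2 + (wpdd τ p / (2 * wpd τ p) - wzeta τ p) * A
    - wp τ p + 3 / 4 * (wpdd τ p / wpd τ p) * wzeta τ p
    + 3 / 16 * (wpdd τ p ^ 2 / wpd τ p ^ 2)

/-- The cubic factor `Y₁(A)`. -/
def Y1 (τ p A : ℂ) : ℂ :=
  A ^ 3 - 5 * wpdd τ p / (4 * wpd τ p) * A ^ 2
    + 3 * (wp τ p + wpdd τ p ^ 2 / (16 * wpd τ p ^ 2)) * A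
    + wpd τ p / 2 - 9 * wpdd τ p / (4 * wpd τ p) * wp τ p
    + 9 / 64 * (wpdd τ p ^ 3 / wpd τ p ^ 3)

/-- The cubic factor `Y₂(A)`. -/
def Y2 (τ p A : ℂ) : ℂ :=
  A ^ 3 - wpdd τ p / (4 * wpd τ p) * A ^ 2
    - 5 / 16 * (wpdd τ p ^ 2 / wpd τ p ^ 2) * A
    + 2 * wpd τ p - 3 / 64 * (wpdd τ p ^ 3 / wpd τ p ^ 3)

/-- The logarithmic derivative of `y_{a,c}` with `a₁ = a₂ = εp`. -/
def phiEps (τ p ε c z : ℂ) : ℂ :=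
  c + 2 * wzeta τ (z - ε * p) - wzeta τ z
    - 1 / 2 * (wzeta τ (z + p) + wzeta τ (z - p))

namespace PeriodPair

variable (L : PeriodPair)

/-- The Weierstrass `ζ`-function of a pair of periods with its pole at the origin removed. -/
def weierstrassZetaExceptZero (z : ℂ) : ℂ :=
  ∑' l : L.lattice, if l.1 = 0 then 0 else (1 / (z - l) + 1 / l + z / l ^ 2)

/-- The Weierstrass `ζ`-function of a pair of periods. -/
def weierstrassZeta (z : ℂ) : ℂ := 1 / z + L.weierstrassZetaExceptZero z

lemma weierstrassZeta_bound (r : ℝ) (s : ℂ) (hs : ‖s‖ < r) (l : ℂ) (hl : l ≠ 0)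
    (h : 2 * r ≤ ‖l‖) :
    ‖1 / (s - l) + 1 / l + s / l ^ 2‖ ≤ 2 * r ^ 2 * ‖l‖ ^ (-3 : ℝ) := by
  have hl0 : 0 < ‖l‖ := norm_pos_iff.mpr hl
  have hr : 0 < r := (norm_nonneg s).trans_lt hs
  have hsl : s - l ≠ 0 := fun e ↦ by rw [sub_eq_zero.mp e] at hs; linarith
  have hlow : ‖l‖ / 2 ≤ ‖s - l‖ := by
    rw [norm_sub_rev]
    exact .trans (by linarith) (norm_sub_norm_le l s)
  calc
    _ = ‖s ^ 2 / ((s - l) * l ^ 2)‖ := by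
      congr 1
      field
    _ = ‖s‖ ^ 2 / (‖s - l‖ * ‖l‖ ^ 2) := by simp
    _ ≤ r ^ 2 / (‖l‖ / 2 * ‖l‖ ^ 2) := by gcongr
    _ = 2 * r ^ 2 / ‖l‖ ^ 3 := by field
    _ = _ := by norm_cast

lemma hasSumLocallyUniformly_weierstrassZetaExceptZero :
    HasSumLocallyUniformly
      (fun (l : L.lattice) (z : ℂ) ↦ if l.1 = 0 then 0 else (1 / (z - l) + 1 / l + z / l ^ 2))
      L.weierstrassZetaExceptZero := by
  refine L.hasSumLocallyUniformly_aux (u := (2 * · ^ 2 * ‖·‖ ^ (-3 : ℝ))) _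
    (fun _ _ ↦ (ZLattice.summable_norm_rpow _ _ (by simp; norm_num)).mul_left _) fun r hr ↦
    Filter.eventually_atTop.mpr ⟨2 * r, ?_⟩
  rintro _ h s hs l rfl
  split_ifs with hl
  · rw [norm_zero]
    positivity
  · exact weierstrassZeta_bound r s hs l hl h

lemma hasDerivAt_weierstrassZetaExceptZero {z : ℂ} (hz : z ∈ ((L.lattice : Set ℂ) \ {0})ᶜ) :
    HasDerivAt L.weierstrassZetaExceptZero (-L.weierstrassPExcept 0 z) z := by
  have hterm (l : L.lattice) (w : ℂ) (hw : w ∈ ((L.lattice : Set ℂ) \ {0})ᶜ) :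
      HasDerivAt (fun z : ℂ ↦ if l.1 = 0 then 0 else (1 / (z - l) + 1 / l + z / l ^ 2))
        (-if l.1 = 0 then 0 else (1 / (w - l) ^ 2 - 1 / l ^ 2)) w := by
    split_ifs with hl
    · simpa using hasDerivAt_const w (0 : ℂ)
    · have hwl : w - l ≠ 0 := fun e ↦ hw ⟨by rw [sub_eq_zero.mp e]; exact l.2,
        by rw [sub_eq_zero.mp e]; exact hl⟩
      have h1 : HasDerivAt (fun z : ℂ ↦ 1 / (z - l)) (-1 / (w - l) ^ 2) w := by
        simpa using ((hasDerivAt_id' w).sub_const (l : ℂ)).fun_inv hwl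
      have h2 : HasDerivAt (fun z : ℂ ↦ z / (l : ℂ) ^ 2) (1 / (l : ℂ) ^ 2) w :=
        (hasDerivAt_id w).div_const _
      convert! (h1.add_const (1 / (l : ℂ))).add h2 using 1
      ring
  have hlim := L.hasSumLocallyUniformly_weierstrassZetaExceptZero.tendstoLocallyUniformlyOn
    (s := ((L.lattice : Set ℂ) \ {0})ᶜ)
  have hF : ∀ s : Finset L.lattice, DifferentiableOn ℂ (fun z : ℂ ↦ ∑ l ∈ s,
      if l.1 = 0 then 0 else (1 / (z - l) + 1 / l + z / l ^ 2)) ((L.lattice : Set ℂ) \ {0})ᶜ :=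
    fun s ↦ .fun_sum fun l _ w hw ↦ (hterm l w hw).differentiableAt.differentiableWithinAt
  have hdiff : DifferentiableOn ℂ L.weierstrassZetaExceptZero ((L.lattice : Set ℂ) \ {0})ᶜ :=
    hlim.differentiableOn (.of_forall hF) L.isOpen_compl_lattice_sdiff
  have hderiv : deriv L.weierstrassZetaExceptZero z = -L.weierstrassPExcept 0 z := by
    refine tendsto_nhds_unique ((TendstoLocallyUniformlyOn.deriv hlim
      (.of_forall hF) L.isOpen_compl_lattice_sdiff).tendsto_at hz)
      ((L.hasSum_weierstrassPExcept 0 z).neg.congr' (.of_forall fun s ↦ ?_))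
    simp only [Function.comp_apply]
    exact (HasDerivAt.fun_sum fun l _ ↦ hterm l z hz).deriv.symm
  rw [← hderiv]
  exact (hdiff.differentiableAt (L.isOpen_compl_lattice_sdiff.mem_nhds hz)).hasDerivAt

lemma weierstrassZetaExceptZero_zero : L.weierstrassZetaExceptZero 0 = 0 := by
  simp [weierstrassZetaExceptZero]

lemma weierstrassZetaExceptZero_neg (z : ℂ) :
    L.weierstrassZetaExceptZero (-z) = -L.weierstrassZetaExceptZero z := by
  simp only [weierstrassZetaExceptZero]
  rw [← (Equiv.neg L.lattice).tsum_eq, ← tsum_neg]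
  congr with l
  simp only [Equiv.neg_apply, NegMemClass.coe_neg, neg_eq_zero]
  split_ifs
  · simp
  · rw [show -z - -(l : ℂ) = -(z - l) by ring]
    simp only [div_neg, neg_div, even_two, Even.neg_pow]
    ring

lemma weierstrassZeta_neg (z : ℂ) : L.weierstrassZeta (-z) = -L.weierstrassZeta z := by
  simp only [weierstrassZeta, weierstrassZetaExceptZero_neg, div_neg]
  ring

lemma weierstrassP_eq_add_weierstrassPExcept_zero (z : ℂ) :
    L.weierstrassP z = 1 / z ^ 2 + L.weierstrassPExcept 0 z := by
  simpa [add_comm] using (L.weierstrassPExcept_add 0 z).symm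

lemma hasDerivAt_weierstrassZeta {z : ℂ} (hz : z ∉ L.lattice) :
    HasDerivAt L.weierstrassZeta (-L.weierstrassP z) z := by
  have hz0 : z ≠ 0 := fun h ↦ hz (h ▸ zero_mem _)
  have h1 : HasDerivAt (fun z : ℂ ↦ 1 / z) (-1 / z ^ 2) z := by
    simpa using (hasDerivAt_id' z).fun_inv hz0
  convert! h1.add (L.hasDerivAt_weierstrassZetaExceptZero (z := z) fun h ↦ hz h.1) using 1
  rw [weierstrassP_eq_add_weierstrassPExcept_zero]
  ring

lemma hasDerivAt_weierstrassP {z : ℂ} (hz : z ∉ L.lattice) :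
    HasDerivAt L.weierstrassP (L.derivWeierstrassP z) z := by
  rw [← deriv_weierstrassP]
  exact (L.analyticOnNhd_weierstrassP z hz).differentiableAt.hasDerivAt

lemma isPreconnected_compl_lattice : IsPreconnected (L.lattice : Set ℂ)ᶜ :=
  (Set.Countable.isConnected_compl_of_one_lt_rank (by simp)
    (countable_of_Lindelof_of_discrete (X := L.lattice))).isPreconnected

lemma exists_weierstrassZeta_add_eq {l : ℂ} (hl : l ∈ L.lattice) :
    ∃ η : ℂ, ∀ z ∉ L.lattice, L.weierstrassZeta (z + l) = L.weierstrassZeta z + η := by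
  have hmem {z : ℂ} (hz : z ∉ L.lattice) : z + l ∉ L.lattice := fun h ↦
    hz (by simpa using sub_mem h hl)
  have hd {z : ℂ} (hz : z ∉ L.lattice) :
      HasDerivAt (fun z ↦ L.weierstrassZeta (z + l)) (-L.weierstrassP z) z := by
    have := (L.hasDerivAt_weierstrassZeta (hmem hz)).comp_add_const z l
    rwa [L.weierstrassP_add_coe z ⟨l, hl⟩] at this
  have h0 := L.ω₁_div_two_notMem_lattice
  refine ⟨L.weierstrassZeta (L.ω₁ / 2 + l) - L.weierstrassZeta (L.ω₁ / 2), fun z hz ↦ ?_⟩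
  refine L.isClosed_lattice.isOpen_compl.eqOn_of_deriv_eq L.isPreconnected_compl_lattice
    (f := fun z ↦ L.weierstrassZeta (z + l)) (g := fun z ↦ L.weierstrassZeta z + _)
    (fun w hw ↦ (hd hw).differentiableAt.differentiableWithinAt)
    (fun w hw ↦ ((L.hasDerivAt_weierstrassZeta hw).add_const
      _).differentiableAt.differentiableWithinAt)
    (fun w hw ↦ ?_) (x := L.ω₁ / 2) h0 (by ring) hz
  rw [(hd hw).deriv, ((L.hasDerivAt_weierstrassZeta hw).add_const _).deriv]

lemma eventually_notMem_lattice {z : ℂ} (hz : z ∉ L.lattice) : ∀ᶠ w in 𝓝 z, w ∉ L.lattice :=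
  L.isClosed_lattice.isOpen_compl.mem_nhds hz

lemma eventually_punctured_notMem_lattice : ∀ᶠ w in 𝓝[≠] (0 : ℂ), w ∉ L.lattice := by
  filter_upwards [self_mem_nhdsWithin, mem_nhdsWithin_of_mem_nhds
    (L.compl_lattice_sdiff_singleton_mem_nhds 0)] with w hw hw' h
  exact hw' ⟨h, hw⟩

/-- The Frobenius–Stickelberger relation `(ζ(z+p) - ζ(z) - ζ(p))² = ℘(z+p) + ℘(z) + ℘(p)`. -/
theorem weierstrassZeta_add_sub_sq {z p : ℂ} (hz : z ∉ L.lattice) (hp : p ∉ L.lattice)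
    (hzp : z + p ∉ L.lattice) :
    (L.weierstrassZeta (z + p) - L.weierstrassZeta z - L.weierstrassZeta p) ^ 2 =
      L.weierstrassP (z + p) + L.weierstrassP z + L.weierstrassP p := by
  classical
  let G : ℂ → ℂ := fun z ↦
    (L.weierstrassZeta (z + p) - L.weierstrassZeta z - L.weierstrassZeta p) ^ 2 -
      (L.weierstrassP (z + p) + L.weierstrassP z + L.weierstrassP p)
  let H : ℂ → ℂ := fun z ↦ if z ∈ L.lattice ∨ z + p ∈ L.lattice then 0 else G z
  have hper (w l : ℂ) (hl : l ∈ L.lattice) : H (w + l) = H w := by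
    have h1 (w : ℂ) : w + l ∈ L.lattice ↔ w ∈ L.lattice :=
      L.lattice.toAddSubgroup.add_mem_cancel_right hl
    have h2 : w + l + p = w + p + l := by ring
    obtain ⟨η, hη⟩ := L.exists_weierstrassZeta_add_eq hl
    have hP (w : ℂ) := L.weierstrassP_add_coe w ⟨l, hl⟩
    simp only [H, G, h2, h1]
    split_ifs with h
    · rfl
    · rw [not_or] at h
      simp only at hP
      rw [hP, hP, hη _ h.1, hη _ h.2]
      ring
  have hsymm (w : ℂ) : H (-p - w) = H w := by
    have h1 : -p - w = -(w + p) := by ring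
    have h2 : -(w + p) + p = -w := by ring
    simp only [H, G, h1, h2, neg_mem_iff, weierstrassZeta_neg, weierstrassP_neg]
    simp only [or_comm (a := w ∈ L.lattice)]
    split_ifs
    · rfl
    · ring
  have hU {w : ℂ} (hw : w ∉ L.lattice) (hwp : w + p ∉ L.lattice) : DifferentiableAt ℂ H w := by
    have hG : DifferentiableAt ℂ G w := by
      have hζ := (L.hasDerivAt_weierstrassZeta hw).differentiableAt
      have hζp := ((L.hasDerivAt_weierstrassZeta hwp).comp_add_const w p).differentiableAt
      have hP := (L.hasDerivAt_weierstrassP hw).differentiableAt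
      have hPp := ((L.hasDerivAt_weierstrassP hwp).comp_add_const w p).differentiableAt
      fun_prop
    refine hG.congr_of_eventuallyEq ?_
    filter_upwards [L.eventually_notMem_lattice hw,
      (continuous_add_const p).continuousAt.eventually (L.eventually_notMem_lattice hwp)]
      with v hv hvp
    simp [H, hv, hvp]
  have hp0 : (0 : ℂ) + p ∉ L.lattice := by simpa using hp
  have hnear : ∀ᶠ w in 𝓝[≠] (0 : ℂ), w ∉ L.lattice ∧ w + p ∉ L.lattice :=
    L.eventually_punctured_notMem_lattice.and (mem_nhdsWithin_of_mem_nhds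
      ((continuous_add_const p).continuousAt.eventually (L.eventually_notMem_lattice hp0)))
  have hH0 : H 0 = 0 := by simp [H]
  have hd0 : DifferentiableAt ℂ H 0 := by
    refine (analyticAt_of_differentiable_on_punctured_nhds_of_continuousAt
      (hnear.mono fun w hw ↦ hU hw.1 hw.2) ?_).differentiableAt
    rw [continuousAt_iff_punctured_nhds, hH0]
    let u : ℂ → ℂ := fun w ↦
      L.weierstrassZeta (w + p) - L.weierstrassZeta p - L.weierstrassZetaExceptZero w
    have hu0 : u 0 = 0 := by simp [u, weierstrassZetaExceptZero_zero]
    have hu : HasDerivAt u (-L.weierstrassP p) 0 := by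
      have h1 := (L.hasDerivAt_weierstrassZeta hp0).comp_add_const 0 p
      have h2 := L.hasDerivAt_weierstrassZetaExceptZero (z := 0) (by simp)
      simpa using (h1.sub_const (L.weierstrassZeta p)).fun_sub h2
    have hslope : Tendsto (fun w ↦ u w / w) (𝓝[≠] 0) (𝓝 (-L.weierstrassP p)) := by
      refine (hasDerivAt_iff_tendsto_slope.mp hu).congr fun w ↦ ?_
      simp [slope_def_field, hu0]
    have hut : Tendsto u (𝓝[≠] 0) (𝓝 0) := by
      simpa [hu0] using hu.continuousAt.tendsto.mono_left nhdsWithin_le_nhds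
    have hPp : Tendsto (fun w ↦ L.weierstrassP (w + p)) (𝓝[≠] 0) (𝓝 (L.weierstrassP p)) := by
      simpa using ((L.hasDerivAt_weierstrassP hp0).comp_add_const 0 p).continuousAt.tendsto.mono_left
        nhdsWithin_le_nhds
    have hP0 : Tendsto (L.weierstrassPExcept 0) (𝓝[≠] 0) (𝓝 0) := by
      simpa using (L.analyticAt_weierstrassPExcept 0).continuousAt.tendsto.mono_left
        nhdsWithin_le_nhds
    have hlim := (((hut.pow 2).sub (hslope.const_mul 2)).sub hPp).sub
      (hP0.add_const (L.weierstrassP p))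
    rw [show (0 : ℂ) ^ 2 - 2 * -L.weierstrassP p - L.weierstrassP p - (0 + L.weierstrassP p) = 0
      by ring] at hlim
    refine hlim.congr' ?_
    filter_upwards [hnear, self_mem_nhdsWithin] with w hw hw0
    have hw0 : w ≠ 0 := hw0
    simp only [H, hw.1, hw.2, or_self, if_false, G, u,
      L.weierstrassP_eq_add_weierstrassPExcept_zero w, weierstrassZeta.eq_1 L w]
    field
  have hdl {l : ℂ} (hl : l ∈ L.lattice) : DifferentiableAt ℂ H l := by
    have h : H = fun w ↦ H (w - l) :=
      funext fun w ↦ by simpa using hper (w - l) l hl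
    rw [h]
    exact DifferentiableAt.fun_comp' l (by simpa using hd0) (by fun_prop)
  have hd : Differentiable ℂ H := fun w ↦ by
    by_cases hw : w ∈ L.lattice
    · exact hdl hw
    by_cases hwp : w + p ∈ L.lattice
    · have h : H = fun w ↦ H (-p - w) := funext fun w ↦ (hsymm w).symm
      rw [h]
      refine DifferentiableAt.fun_comp' w (hdl ?_) (by fun_prop)
      rw [show -p - w = -(w + p) by ring]
      exact neg_mem hwp
    · exact hU hw hwp
  have hH := hd.apply_eq_apply_of_bounded (IsZLattice.isCompact_range_of_periodic L.lattice H
    hd.continuous fun z w hw ↦ hper z w hw).isBounded z 0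
  rw [hH0] at hH
  simpa [H, hz, hzp, G, sub_eq_zero] using hH

lemma weierstrassZeta_add_sub_mul_aux {x y : ℂ} (hx : x ∉ L.lattice) (hy : y ∉ L.lattice)
    (hxy : x + y ∉ L.lattice) :
    2 * (L.weierstrassZeta (x + y) - L.weierstrassZeta x - L.weierstrassZeta y) *
      (L.weierstrassP x - L.weierstrassP (x + y)) =
      L.derivWeierstrassP (x + y) + L.derivWeierstrassP x := by
  have h1 := ((((L.hasDerivAt_weierstrassZeta hxy).comp_add_const x y).fun_sub
    (L.hasDerivAt_weierstrassZeta hx)).sub_const (L.weierstrassZeta y)).fun_pow 2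
  have h2 := (((L.hasDerivAt_weierstrassP hxy).comp_add_const x y).fun_add
    (L.hasDerivAt_weierstrassP hx)).add_const (L.weierstrassP y)
  have h3 := h2.congr_of_eventuallyEq (f₁ := fun z ↦
      (L.weierstrassZeta (z + y) - L.weierstrassZeta z - L.weierstrassZeta y) ^ 2) (by
    filter_upwards [L.eventually_notMem_lattice hx,
      (continuous_add_const y).continuousAt.eventually (L.eventually_notMem_lattice hxy)]
      with z hz hzy
    exact L.weierstrassZeta_add_sub_sq hz hy hzy)
  have := h1.unique h3
  rw [← this]
  push_cast
  ring

/-- The addition formula for `ζ`, in a form without denominators. -/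
lemma weierstrassZeta_add_sub_mul {x y : ℂ} (hx : x ∉ L.lattice) (hy : y ∉ L.lattice)
    (hxy : x + y ∉ L.lattice) :
    2 * (L.weierstrassZeta (x + y) - L.weierstrassZeta x - L.weierstrassZeta y) *
      (L.weierstrassP x - L.weierstrassP y) = L.derivWeierstrassP x - L.derivWeierstrassP y := by
  have h1 := L.weierstrassZeta_add_sub_mul_aux hx hy hxy
  have h2 := L.weierstrassZeta_add_sub_mul_aux hy hx (by rwa [add_comm])
  rw [add_comm y x] at h2
  linear_combination h1 - h2

lemma notMem_lattice_of_two_mul_notMem {p : ℂ} (hp : 2 * p ∉ L.lattice) : p ∉ L.lattice :=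
  fun h ↦ hp (by rw [two_mul]; exact add_mem h h)

/-- The duplication formula for `ζ`, in a form without denominators. -/
lemma weierstrassZeta_two_mul_sub {p : ℂ} (hp : 2 * p ∉ L.lattice) :
    2 * (L.weierstrassZeta (2 * p) - 2 * L.weierstrassZeta p) * L.derivWeierstrassP p =
      deriv L.derivWeierstrassP p := by
  have hp1 := L.notMem_lattice_of_two_mul_notMem hp
  rw [two_mul] at hp
  have h1 := ((((L.hasDerivAt_weierstrassZeta hp).comp_add_const p p).fun_sub
    (L.hasDerivAt_weierstrassZeta hp1)).sub_const (L.weierstrassZeta p)).const_mul 2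
  have h2 := (L.hasDerivAt_weierstrassP hp1).sub_const (L.weierstrassP p)
  have h3 := (L.analyticOnNhd_derivWeierstrassP p hp1).differentiableAt.hasDerivAt.sub_const
    (L.derivWeierstrassP p)
  have h4 := h3.congr_of_eventuallyEq (f₁ := fun z ↦
      2 * (L.weierstrassZeta (z + p) - L.weierstrassZeta z - L.weierstrassZeta p) *
      (L.weierstrassP z - L.weierstrassP p)) (by
    filter_upwards [L.eventually_notMem_lattice hp1,
      (continuous_add_const p).continuousAt.eventually (L.eventually_notMem_lattice hp)]
      with z hz hzp
    exact L.weierstrassZeta_add_sub_mul hz hp1 hzp)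
  rw [← (h1.fun_mul h2).unique h4, two_mul p]
  ring

/-- `℘'` does not vanish identically off the lattice. -/
lemma not_eqOn_derivWeierstrassP_zero : ¬ Set.EqOn L.derivWeierstrassP 0 (L.lattice : Set ℂ)ᶜ := by
  intro h
  have h1 : Tendsto (fun z ↦ z ^ 3 * L.derivWeierstrassPExcept 0 z) (𝓝[≠] 0) (𝓝 0) := by
    have : ContinuousAt (fun z ↦ z ^ 3 * L.derivWeierstrassPExcept 0 z) 0 :=
      (by fun_prop : ContinuousAt (fun z : ℂ ↦ z ^ 3) 0).mul
        (L.analyticAt_derivWeierstrassPExcept 0).continuousAt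
    simpa using this.tendsto.mono_left nhdsWithin_le_nhds
  have h2 : Tendsto (fun z ↦ z ^ 3 * L.derivWeierstrassPExcept 0 z) (𝓝[≠] 0) (𝓝 2) := by
    refine tendsto_const_nhds.congr' ?_
    filter_upwards [L.eventually_punctured_notMem_lattice, self_mem_nhdsWithin] with z hz hz0
    have hz0 : z ≠ 0 := hz0
    have h3 := L.derivWeierstrassPExcept_def 0 z
    rw [h hz] at h3
    simp only [Submodule.coe_zero, Pi.zero_apply, zero_add, sub_zero] at h3
    rw [h3]
    field
  exact two_ne_zero (tendsto_nhds_unique h2 h1)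

/-- The zeros of `℘'` off the lattice are half-periods. -/
theorem derivWeierstrassP_ne_zero {p : ℂ} (hp : 2 * p ∉ L.lattice) :
    L.derivWeierstrassP p ≠ 0 := by
  intro h0
  have hp1 := L.notMem_lattice_of_two_mul_notMem hp
  have hf := L.analyticOnNhd_derivWeierstrassP p hp1
  set h : ℂ → ℂ := fun z ↦ 2 * (L.weierstrassZeta (2 * z) - 2 * L.weierstrassZeta z) with hh
  have hev : ∀ᶠ z in 𝓝 p, 2 * z ∉ L.lattice :=
    (continuous_const_mul 2).continuousAt.eventually (L.eventually_notMem_lattice hp)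
  have hha : AnalyticAt ℂ h p := by
    rw [Complex.analyticAt_iff_eventually_differentiableAt]
    filter_upwards [hev] with z hz
    have h1 := (L.hasDerivAt_weierstrassZeta hz).differentiableAt
    have h2 := (L.hasDerivAt_weierstrassZeta
      (L.notMem_lattice_of_two_mul_notMem hz)).differentiableAt
    have h3 : DifferentiableAt ℂ (fun z ↦ L.weierstrassZeta (2 * z)) z :=
      h1.fun_comp' z (by fun_prop)
    fun_prop
  have heq : deriv L.derivWeierstrassP =ᶠ[𝓝 p] h * L.derivWeierstrassP := by
    filter_upwards [hev] with z hz
    exact (L.weierstrassZeta_two_mul_sub hz).symm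
  have hord := hf.analyticOrderAt_deriv_add_one
  simp only [h0, sub_zero] at hord
  rw [analyticOrderAt_congr heq, analyticOrderAt_mul hha hf] at hord
  have htop : analyticOrderAt L.derivWeierstrassP p = ⊤ := by
    by_contra hne
    have hle : analyticOrderAt L.derivWeierstrassP p + 1 ≤ analyticOrderAt L.derivWeierstrassP p :=
      calc
        _ ≤ analyticOrderAt h p + analyticOrderAt L.derivWeierstrassP p + 1 := by
          gcongr
          exact le_add_self
        _ = _ := hord
    exact (ENat.add_one_le_iff hne).mp hle |>.false
  exact L.not_eqOn_derivWeierstrassP_zero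
    (L.analyticOnNhd_derivWeierstrassP.eqOn_zero_of_preconnected_of_eventuallyEq_zero
      L.isPreconnected_compl_lattice hp1 (analyticOrderAt_eq_top.mp htop))

lemma tendsto_mul_weierstrassZeta :
    Tendsto (fun z ↦ z * L.weierstrassZeta z) (𝓝[≠] 0) (𝓝 1) := by
  have h := (L.hasDerivAt_weierstrassZetaExceptZero (z := 0) (by simp)).continuousAt
  have h1 : Tendsto (fun z ↦ 1 + z * L.weierstrassZetaExceptZero z) (𝓝[≠] 0) (𝓝 1) := by
    have : ContinuousAt (fun z ↦ 1 + z * L.weierstrassZetaExceptZero z) 0 := by fun_prop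
    simpa using this.tendsto.mono_left nhdsWithin_le_nhds
  refine h1.congr' ?_
  filter_upwards [self_mem_nhdsWithin] with z hz
  have hz : z ≠ 0 := hz
  simp only [weierstrassZeta]
  field

/-- A multiple of `ζ(· - x)` that extends continuously to `x` is trivial. -/
lemma eq_zero_of_mul_weierstrassZeta_eventuallyEq {a x : ℂ} {g : ℂ → ℂ} (hg : ContinuousAt g x)
    (h : ∀ᶠ z in 𝓝[≠] x, a * L.weierstrassZeta (z - x) = g z) : a = 0 := by
  have hsub : Tendsto (fun z ↦ z - x) (𝓝[≠] x) (𝓝[≠] 0) := by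
    refine tendsto_nhdsWithin_iff.mpr ⟨?_, ?_⟩
    · have : ContinuousAt (fun z ↦ z - x) x := by fun_prop
      simpa using this.tendsto.mono_left nhdsWithin_le_nhds
    · filter_upwards [self_mem_nhdsWithin] with z hz
      exact sub_ne_zero.mpr hz
  have h1 := (L.tendsto_mul_weierstrassZeta.comp hsub).const_mul a
  have h2 : Tendsto (fun z ↦ (z - x) * g z) (𝓝[≠] x) (𝓝 0) := by
    have : ContinuousAt (fun z ↦ (z - x) * g z) x := by fun_prop
    simpa using this.tendsto.mono_left nhdsWithin_le_nhds
  have h3 : Tendsto (fun z ↦ (z - x) * g z) (𝓝[≠] x) (𝓝 (a * 1)) := by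
    refine h1.congr' ?_
    filter_upwards [h] with z hz
    rw [← hz]
    simp only [Function.comp_apply]
    ring
  simpa using tendsto_nhds_unique h3 h2

/-- The Riccati equation for `φ = 2ζ(p) + 2ζ(z-p) - ζ(z) - (ζ(z+p) + ζ(z-p))/2`, where the
first bracket on the left is `φ'(z)`. -/
theorem riccati_identity {p z : ℂ} (hp : 2 * p ∉ L.lattice) (hz : z ∉ L.lattice)
    (hzm : z - p ∉ L.lattice) (hzp : z + p ∉ L.lattice) :
    (-2 * L.weierstrassP (z - p) + L.weierstrassP z
        + 1 / 2 * (L.weierstrassP (z + p) + L.weierstrassP (z - p)))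
      + (2 * L.weierstrassZeta p + 2 * L.weierstrassZeta (z - p) - L.weierstrassZeta z
        - 1 / 2 * (L.weierstrassZeta (z + p) + L.weierstrassZeta (z - p))) ^ 2 =
      2 * L.weierstrassP z + 3 / 4 * (L.weierstrassP (z + p) + L.weierstrassP (z - p))
        + 3 / 2 * (L.weierstrassZeta (2 * p) - 2 * L.weierstrassZeta p)
          * (L.weierstrassZeta (z + p) - L.weierstrassZeta (z - p))
        + ((3 / 2 * (L.weierstrassZeta (2 * p) - 2 * L.weierstrassZeta p)) ^ 2
          - L.weierstrassZeta (2 * p)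
            * (3 / 2 * (L.weierstrassZeta (2 * p) - 2 * L.weierstrassZeta p))
          - 3 / 4 * L.weierstrassP (2 * p) - 2 * L.weierstrassP p) := by
  have hp1 := L.notMem_lattice_of_two_mul_notMem hp
  have e1 := L.weierstrassZeta_add_sub_sq hz hp1 hzp
  have e2 := L.weierstrassZeta_add_sub_sq hz (p := -p) (by simpa using hp1)
    (by simpa [← sub_eq_add_neg] using hzm)
  rw [← sub_eq_add_neg, weierstrassZeta_neg, weierstrassP_neg] at e2
  have h3 : z - p + 2 * p = z + p := by ring
  have e3 := L.weierstrassZeta_add_sub_sq hzm hp (by rwa [h3])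
  rw [h3] at e3
  have e4 := L.weierstrassZeta_add_sub_sq hp1 hp1 (by rwa [← two_mul])
  rw [← two_mul] at e4
  linear_combination 3 / 2 * e2 - 1 / 2 * e1 + 3 / 4 * e3 - 3 / 2 * e4

theorem riccati_iff {p : ℂ} (hp : 2 * p ∉ L.lattice) (c A : ℂ) :
    (∀ z, z ∉ L.lattice → z - p ∉ L.lattice → z + p ∉ L.lattice →
      (-2 * L.weierstrassP (z - p) + L.weierstrassP z
          + 1 / 2 * (L.weierstrassP (z + p) + L.weierstrassP (z - p)))
        + (c + 2 * L.weierstrassZeta (z - p) - L.weierstrassZeta z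
          - 1 / 2 * (L.weierstrassZeta (z + p) + L.weierstrassZeta (z - p))) ^ 2 =
        2 * L.weierstrassP z + 3 / 4 * (L.weierstrassP (z + p) + L.weierstrassP (z - p))
          + A * (L.weierstrassZeta (z + p) - L.weierstrassZeta (z - p))
          + (A ^ 2 - L.weierstrassZeta (2 * p) * A
            - 3 / 4 * L.weierstrassP (2 * p) - 2 * L.weierstrassP p)) ↔
      c = 2 * L.weierstrassZeta p ∧
        A = 3 / 2 * (L.weierstrassZeta (2 * p) - 2 * L.weierstrassZeta p) := by
  refine ⟨fun h ↦ ?_, ?_⟩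
  swap
  · rintro ⟨rfl, rfl⟩ z hz hzm hzp
    exact L.riccati_identity hp hz hzm hzp
  have hp1 := L.notMem_lattice_of_two_mul_notMem hp
  set c₀ := 2 * L.weierstrassZeta p with hc₀
  set A₀ := 3 / 2 * (L.weierstrassZeta (2 * p) - 2 * L.weierstrassZeta p) with hA₀
  have hζ {x a : ℂ} (hx : x + a ∉ L.lattice) :
      ContinuousAt (fun z ↦ L.weierstrassZeta (z + a)) x :=
    ((L.hasDerivAt_weierstrassZeta hx).comp_add_const x a).continuousAt
  have hev {x a : ℂ} (hx : x + a ∉ L.lattice) : ∀ᶠ z in 𝓝[≠] x, z + a ∉ L.lattice :=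
    mem_nhdsWithin_of_mem_nhds
      ((continuous_add_const a).continuousAt.eventually (L.eventually_notMem_lattice hx))
  have hc : c = c₀ := by
    have h0p : (0 : ℂ) + p ∉ L.lattice := by simpa using hp1
    have h0m : (0 : ℂ) + -p ∉ L.lattice := by simpa using hp1
    have hcp := hζ h0p
    have hcm := hζ h0m
    have := L.eq_zero_of_mul_weierstrassZeta_eventuallyEq (a := 2 * (c - c₀)) (x := 0)
      (g := fun z ↦ 2 * (c - c₀) * (c₀ + 2 * L.weierstrassZeta (z + -p)
          - 1 / 2 * (L.weierstrassZeta (z + p) + L.weierstrassZeta (z + -p))) + (c - c₀) ^ 2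
        - (A - A₀) * (L.weierstrassZeta (z + p) - L.weierstrassZeta (z + -p))
        - (A ^ 2 - L.weierstrassZeta (2 * p) * A - (A₀ ^ 2 - L.weierstrassZeta (2 * p) * A₀)))
      (by fun_prop) (by
        filter_upwards [hev h0p, hev h0m, L.eventually_punctured_notMem_lattice] with z h1 h2 h3
        rw [← sub_eq_add_neg] at h2
        simp only [← sub_eq_add_neg, sub_zero]
        linear_combination L.riccati_identity hp h3 h2 h1 - h z h3 h2 h1)
    exact sub_eq_zero.mp (by simpa using this)
  refine ⟨hc, ?_⟩
  have hpp : p + p ∉ L.lattice := by rwa [← two_mul]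
  have hcp := hζ hpp
  have hsub : ∀ᶠ z in 𝓝[≠] p, z - p ∉ L.lattice := by
    filter_upwards [self_mem_nhdsWithin, mem_nhdsWithin_of_mem_nhds
      ((continuous_sub_right p).continuousAt.eventually
        (p := fun w ↦ w ∈ ((L.lattice : Set ℂ) \ {p - p})ᶜ)
        (L.compl_lattice_sdiff_singleton_mem_nhds (p - p)))] with z hz hz' hmem
    exact hz' ⟨hmem, fun e ↦ hz (sub_left_inj.mp e)⟩
  have := L.eq_zero_of_mul_weierstrassZeta_eventuallyEq (a := A - A₀) (x := p)
    (g := fun z ↦ (A - A₀) * L.weierstrassZeta (z + p)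
      + (A ^ 2 - L.weierstrassZeta (2 * p) * A - (A₀ ^ 2 - L.weierstrassZeta (2 * p) * A₀)))
    (by fun_prop) (by
      filter_upwards [hev hpp, hsub, hev (a := 0) (by simpa using hp1)] with z h1 h2 h3
      rw [add_zero] at h3
      have e := h z h3 h2 h1
      rw [hc] at e
      linear_combination e - L.riccati_identity hp h3 h2 h1)
  exact sub_eq_zero.mp this

/-- `3℘''(p)/(4℘'(p))` in terms of `ζ`. -/
lemma three_mul_deriv_div {p : ℂ} (hp : 2 * p ∉ L.lattice) :
    3 * deriv L.derivWeierstrassP p / (4 * L.derivWeierstrassP p) =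
      3 / 2 * (L.weierstrassZeta (2 * p) - 2 * L.weierstrassZeta p) := by
  have h := L.derivWeierstrassP_ne_zero hp
  rw [← L.weierstrassZeta_two_mul_sub hp]
  field

end PeriodPair

open PeriodPair

lemma linearIndependent_one_of_im_pos {τ : ℂ} (hτ : 0 < τ.im) :
    LinearIndependent ℝ ![(1 : ℂ), τ] := by
  rw [LinearIndependent.pair_iff]
  intro s t h
  have him := congrArg Complex.im h
  have hre := congrArg Complex.re h
  simp at him hre
  have ht : t = 0 := him.resolve_right hτ.ne'
  exact ⟨by simpa [ht] using hre, ht⟩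

/-- The pair of periods `(1, τ)`. -/
def periodPairOne {τ : ℂ} (hτ : 0 < τ.im) : PeriodPair :=
  ⟨1, τ, linearIndependent_one_of_im_pos hτ⟩

section

variable {τ : ℂ} (hτ : 0 < τ.im)

lemma mem_Lam_iff (z : ℂ) : z ∈ Lam τ ↔ z ∈ (periodPairOne hτ).lattice := by
  simp [Lam, PeriodPair.mem_lattice, periodPairOne, eq_comm]

lemma Lam_eq : Lam τ = (periodPairOne hτ).lattice := Set.ext (mem_Lam_iff hτ)

lemma tsum_Lam'_eq (f : ℂ → ℂ) :
    ∑' ω : Lam' τ, f ω = ∑' l : (periodPairOne hτ).lattice, if l.1 = 0 then 0 else f l := by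
  classical
  have h (l : (periodPairOne hτ).lattice) :
      (if l.1 = 0 then 0 else f l) = (Lam' τ).indicator f l := by
    simp only [Lam', Set.indicator_apply, Set.mem_ofPred_eq, mem_Lam_iff hτ, l.2, true_and, ne_eq]
    split_ifs <;> rfl
  simp_rw [h]
  rw [tsum_subtype (Lam' τ) f]
  refine (tsum_subtype_eq_of_support_subset (s := ((periodPairOne hτ).lattice : Set ℂ)) ?_).symm
  intro z hz
  have := Set.mem_of_indicator_ne_zero hz
  exact (mem_Lam_iff hτ z).mp this.1

lemma wp_eq : wp τ = (periodPairOne hτ).weierstrassP := by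
  funext z
  rw [weierstrassP_eq_add_weierstrassPExcept_zero, wp, weierstrassPExcept,
    tsum_Lam'_eq hτ fun ω ↦ 1 / (z - ω) ^ 2 - 1 / ω ^ 2]

lemma wzeta_eq : wzeta τ = (periodPairOne hτ).weierstrassZeta := by
  funext z
  rw [weierstrassZeta, wzeta, weierstrassZetaExceptZero,
    tsum_Lam'_eq hτ fun ω ↦ 1 / (z - ω) + 1 / ω + z / ω ^ 2]

lemma notMem_Sset_iff (p z : ℂ) :
    z ∉ Sset τ p ↔ z ∉ (periodPairOne hτ).lattice ∧ z - p ∉ (periodPairOne hτ).lattice ∧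
      z + p ∉ (periodPairOne hτ).lattice := by
  simp [Sset, mem_Lam_iff hτ, not_or, and_assoc]

lemma deriv_phiEps {p ε c z : ℂ} (hz : z ∉ (periodPairOne hτ).lattice)
    (hzm : z - p ∉ (periodPairOne hτ).lattice) (hzp : z + p ∉ (periodPairOne hτ).lattice)
    (hzε : z - ε * p ∉ (periodPairOne hτ).lattice) :
    deriv (phiEps τ p ε c) z = -2 * wp τ (z - ε * p) + wp τ z
      + 1 / 2 * (wp τ (z + p) + wp τ (z - p)) := by
  have hε := ((periodPairOne hτ).hasDerivAt_weierstrassZeta hzε).comp_sub_const z (ε * p)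
  have h0 := (periodPairOne hτ).hasDerivAt_weierstrassZeta hz
  have hp := ((periodPairOne hτ).hasDerivAt_weierstrassZeta hzp).comp_add_const z p
  have hm := ((periodPairOne hτ).hasDerivAt_weierstrassZeta hzm).comp_sub_const z p
  rw [← wzeta_eq, ← wp_eq] at hε h0 hp hm
  have h := (((hε.const_mul 2).const_add c).fun_sub h0).fun_sub ((hp.fun_add hm).const_mul (1 / 2))
  exact h.deriv.trans (by ring)

end

/-- with `a₁ = a₂ = εp` (`ε = ±1`), `y_{a,c}` solves `y'' = q(·;A) y`
on `ℂ ∖ S` iff `c = 2εζ(p)` and `A = 3℘''(p)/(4℘'(p))`. -/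
theorem stmt_7 (τ p : ℂ) (hτ : 0 < τ.im) (hp : 2 * p ∉ Lam τ)
    (ε : ℂ) (hε : ε = 1 ∨ ε = -1) (c : ℂ) (A : ℂ) :
    (∀ z ∉ Sset τ p,
        deriv (phiEps τ p ε c) z + (phiEps τ p ε c z) ^ 2 = qpot τ p A z) ↔
      (c = 2 * ε * wzeta τ p ∧ A = 3 * wpdd τ p / (4 * wpd τ p)) := by
  have hwpd : wpd τ = (periodPairOne hτ).derivWeierstrassP := by
    rw [wpd, wp_eq hτ, deriv_weierstrassP]
  have hwpdd : wpdd τ = deriv (periodPairOne hτ).derivWeierstrassP := by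
    rw [wpdd, wp_eq hτ, deriv_weierstrassP]
  rw [mem_Lam_iff hτ] at hp
  have hA := (periodPairOne hτ).three_mul_deriv_div hp
  simp only [notMem_Sset_iff hτ, and_imp]
  rw [hwpd, hwpdd, hA, wzeta_eq hτ]
  rcases hε with rfl | rfl
  · rw [mul_one, ← (periodPairOne hτ).riccati_iff hp c A]
    refine forall₄_congr fun z hz hzm hzp ↦ ?_
    rw [deriv_phiEps hτ hz hzm hzp (by rwa [one_mul])]
    simp only [phiEps, qpot, Bc, wzeta_eq hτ, wp_eq hτ, one_mul]
  · have hp' : 2 * -p ∉ (periodPairOne hτ).lattice := by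
      rwa [mul_neg, neg_mem_iff]
    have hiff := (periodPairOne hτ).riccati_iff hp' c (-A)
    have hconst : (c = 2 * -1 * (periodPairOne hτ).weierstrassZeta p ∧
        A = 3 / 2 * ((periodPairOne hτ).weierstrassZeta (2 * p)
          - 2 * (periodPairOne hτ).weierstrassZeta p)) ↔
        (c = 2 * (periodPairOne hτ).weierstrassZeta (-p) ∧
        -A = 3 / 2 * ((periodPairOne hτ).weierstrassZeta (2 * -p)
          - 2 * (periodPairOne hτ).weierstrassZeta (-p))) := by
      rw [mul_neg 2 p, weierstrassZeta_neg, weierstrassZeta_neg, ← neg_inj (a := A)]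
      ring_nf
    rw [hconst, ← hiff]
    refine forall_congr' fun z ↦ forall_congr' fun hz ↦ ?_
    rw [sub_neg_eq_add, ← sub_eq_add_neg]
    rw [forall_comm]
    refine forall₂_congr fun hzp hzm ↦ ?_
    rw [deriv_phiEps hτ hz hzm hzp (by simpa using hzp)]
    simp only [phiEps, qpot, Bc, wzeta_eq hτ, wp_eq hτ, neg_one_mul, sub_neg_eq_add, mul_neg 2 p,
      weierstrassZeta_neg, weierstrassP_neg]
    ring_nf
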